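/- arXiv:math/0501083 — 2 statements merged into one kernel-verified Lean document; each statement's English description precedes it below -/
import Mathlib

section
/- Let B be a unital complex Banach algebra, take I = {1,2} in the Fock-space construction, let N ≥ 1, choose α₀ ∈ B and bounded n-multilinear maps α_n : Bⁿ → B for n ∈ {1,…,N}, and set F(b) = α₀ + Σ_{n=1}^{N} α_n(b,…,b). Let X = L₁ + Σ_{n=0}^{N} V_{1,n}(α_n) ∈ B(𝔉). Then, with respect to the expectation ℰ, the R-transform of X satisfies R_X(b) = F(b) for all b in a neighborhood of 0 in B. -/
open scoped Topology ENNReal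

noncomputable section

variable (B : Type*) [NormedRing B] [NormedAlgebra ℂ B] [CompleteSpace B]
variable (I : Type*) [DecidableEq I]

abbrev D := lp (fun _ : I => B) 1

def delta (i : I) : D B I := lp.single 1 i (1 : B)

def lsmul (b : B) (d : D B I) : D B I :=
  ⟨fun i => b * d i, by
    apply memℓp_gen
    have h1 : Summable fun i => ‖d i‖ ^ (1 : ℝ≥0∞).toReal :=
      (lp.memℓp d).summable (by norm_num)
    simp only [ENNReal.toReal_one, Real.rpow_one] at h1 ⊢
    exact Summable.of_nonneg_of_le (fun i => norm_nonneg _)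
      (fun i => norm_mul_le b (d i)) (h1.mul_left ‖b‖)⟩

/-- The Fock-space construction of Dykema's paper: `F` plays the role of
`𝔉 = BΩ ⊕ ⨁_{k ≥ 1} D^{⊗̂k} ⊗̂ B`, with `τ k d b₀` the elementary tensor
`d 0 ⊗ ⋯ ⊗ d k ⊗ b₀` (`k+1` factors from `D`), `lam` the left action of `B`,
`rho` the right action of `B`, `P` the projection onto `BΩ` and the operators
`L i`, `V i n αₙ`, `W i n αₙ` as defined in the paper. -/
structure FockSetup (F : Type*) [NormedAddCommGroup F] [NormedSpace ℂ F] [CompleteSpace F] where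
  Ω : F
  τ : (k : ℕ) → (Fin (k + 1) → D B I) → B → F
  lam : B →ₐ[ℂ] (F →L[ℂ] F)
  rho : B → (F →L[ℂ] F)
  P : F →L[ℂ] B
  L : I → (F →L[ℂ] F)
  V : (i : I) → (n : ℕ) → ContinuousMultilinearMap ℂ (fun _ : Fin n => B) B → (F →L[ℂ] F)
  W : (i : I) → (n : ℕ) → ContinuousMultilinearMap ℂ (fun _ : Fin n => B) B → (F →L[ℂ] F)
  dense_span : Dense (↑(Submodule.span ℂ
      ((Set.range fun b : B => lam b Ω) ∪
        {x | ∃ (k : ℕ) (d : Fin (k + 1) → D B I) (b₀ : B), x = τ k d b₀})) : Set F)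
  lam_tensor : ∀ (b : B) (k : ℕ) (d : Fin (k + 1) → D B I) (b₀ : B),
    lam b (τ k d b₀) = τ k (Function.update d 0 (lsmul B I b (d 0))) b₀
  rho_lam_omega : ∀ b b₀ : B, rho b (lam b₀ Ω) = lam (b₀ * b) Ω
  rho_tensor : ∀ (b : B) (k : ℕ) (d : Fin (k + 1) → D B I) (b₀ : B),
    rho b (τ k d b₀) = τ k d (b₀ * b)
  P_lam_omega : ∀ b : B, P (lam b Ω) = b
  P_tensor : ∀ (k : ℕ) (d : Fin (k + 1) → D B I) (b₀ : B), P (τ k d b₀) = 0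
  L_omega : ∀ (i : I) (b₀ : B), L i (lam b₀ Ω) = τ 0 (fun _ => delta B I i) b₀
  L_tensor : ∀ (i : I) (k : ℕ) (d : Fin (k + 1) → D B I) (b₀ : B),
    L i (τ k d b₀) = τ (k + 1) (Fin.cons (delta B I i) d) b₀
  V_zero : ∀ (i : I) (α : ContinuousMultilinearMap ℂ (fun _ : Fin 0 => B) B),
    V i 0 α = lam (α 0)
  W_zero : ∀ (i : I) (α : ContinuousMultilinearMap ℂ (fun _ : Fin 0 => B) B),
    W i 0 α = lam (α 0) * L i
  V_omega : ∀ (i : I) (n : ℕ), 1 ≤ n →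
    ∀ (α : ContinuousMultilinearMap ℂ (fun _ : Fin n => B) B) (b₀ : B),
      V i n α (lam b₀ Ω) = 0
  W_omega : ∀ (i : I) (n : ℕ), 1 ≤ n →
    ∀ (α : ContinuousMultilinearMap ℂ (fun _ : Fin n => B) B) (b₀ : B),
      W i n α (lam b₀ Ω) = 0
  V_tensor_lt : ∀ (i : I) (n : ℕ) (α : ContinuousMultilinearMap ℂ (fun _ : Fin n => B) B)
      (k : ℕ) (d : Fin (k + 1) → D B I) (b₀ : B), k + 1 < n →
    V i n α (τ k d b₀) = 0
  W_tensor_lt : ∀ (i : I) (n : ℕ) (α : ContinuousMultilinearMap ℂ (fun _ : Fin n => B) B)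
      (k : ℕ) (d : Fin (k + 1) → D B I) (b₀ : B), k + 1 < n →
    W i n α (τ k d b₀) = 0
  V_tensor_eq : ∀ (i : I) (k : ℕ) (α : ContinuousMultilinearMap ℂ (fun _ : Fin (k + 1) => B) B)
      (d : Fin (k + 1) → D B I) (b₀ : B),
    V i (k + 1) α (τ k d b₀) = lam (α (fun j => d j i) * b₀) Ω
  W_tensor_eq : ∀ (i : I) (k : ℕ) (α : ContinuousMultilinearMap ℂ (fun _ : Fin (k + 1) => B) B)
      (d : Fin (k + 1) → D B I) (b₀ : B),
    W i (k + 1) α (τ k d b₀) = lam (α (fun j => d j i)) (τ 0 (fun _ => delta B I i) b₀)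
  V_tensor_gt : ∀ (i : I) (n : ℕ), 1 ≤ n →
    ∀ (α : ContinuousMultilinearMap ℂ (fun _ : Fin n => B) B)
      (k : ℕ) (d : Fin (k + 1) → D B I) (b₀ : B) (h : n ≤ k),
    V i n α (τ k d b₀) =
      lam (α fun j => d (Fin.castLE (by omega) j) i)
        (τ (k - n) (fun j : Fin (k - n + 1) => d ⟨n + (j : ℕ), by omega⟩) b₀)
  W_tensor_gt : ∀ (i : I) (n : ℕ), 1 ≤ n →
    ∀ (α : ContinuousMultilinearMap ℂ (fun _ : Fin n => B) B)
      (k : ℕ) (d : Fin (k + 1) → D B I) (b₀ : B) (h : n ≤ k),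
    W i n α (τ k d b₀) =
      lam (α fun j => d (Fin.castLE (by omega) j) i)
        (τ (k - n + 1) (Fin.cons (delta B I i)
          (fun j : Fin (k - n + 1) => d ⟨n + (j : ℕ), by omega⟩)) b₀)

variable {B} {I}
variable {F : Type*} [NormedAddCommGroup F] [NormedSpace ℂ F] [CompleteSpace F]

/-- The expectation `ℰ(X) = P(XΩ)`. -/
def FockSetup.Ec (S : FockSetup B I F) (X : F →L[ℂ] F) : B := S.P (X S.Ω)

/-- `𝒞_X(b) = ℰ((1 - bX)⁻¹ b)` for an operator `X` on the Fock space (with `b` acting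
via `λ`). -/
def FockSetup.Ca (S : FockSetup B I F) (X : F →L[ℂ] F) (b : B) : B :=
  S.Ec (Ring.inverse (1 - S.lam b * X) * S.lam b)

/-- `R` is (a version of) the R-transform of `X` with respect to `ℰ`: `R` is analytic near `0`
and `b ↦ (1 + b R(b))⁻¹ b` is a local right inverse of `𝒞_X`. -/
def FockSetup.IsRTransform (S : FockSetup B I F) (X : F →L[ℂ] F) (R : B → B) : Prop :=
  AnalyticAt ℂ R 0 ∧
    ∀ᶠ b in nhds (0 : B), S.Ca X (Ring.inverse (1 + b * R b) * b) = b

set_option linter.unusedSectionVars false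

theorem AnalyticAt.eventuallyEq_of_forall_isUnit {f g : B → B} (hf : AnalyticAt ℂ f 0)
    (hg : AnalyticAt ℂ g 0) (h : ∀ᶠ b in 𝓝 (0 : B), IsUnit b → f b = g b) : f =ᶠ[𝓝 0] g := by
  obtain ⟨r, hr, hball⟩ := Metric.eventually_nhds_iff_ball.1
    (hf.eventually_analyticAt.and (hg.eventually_analyticAt.and h))
  have hline : Filter.Tendsto (fun z : ℂ => z • (1 : B)) (𝓝[≠] 0) (𝓝 0) := by
    have : Continuous fun z : ℂ => z • (1 : B) := by fun_prop
    simpa using (this.tendsto 0).mono_left nhdsWithin_le_nhds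
  obtain ⟨z, hz, hz0⟩ :=
    ((hline.eventually (Metric.ball_mem_nhds (0 : B) hr)).and self_mem_nhdsWithin).exists
  have hunit : IsUnit (z • (1 : B)) := by
    simpa [Algebra.algebraMap_eq_smul_one] using (IsUnit.mk0 z hz0).map (algebraMap ℂ B)
  have hev : f =ᶠ[𝓝 (z • (1 : B))] g := by
    filter_upwards [Metric.isOpen_ball.mem_nhds hz, Units.isOpen.mem_nhds hunit] with b hb hub
    exact (hball b hb).2.2 hub
  have hU : IsPreconnected (Metric.ball (0 : B) r) := by
    let _ : NormedSpace ℝ B := NormedSpace.restrictScalars ℝ ℂ B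
    exact (convex_ball (0 : B) r).isPreconnected
  have heq := AnalyticOnNhd.eqOn_of_preconnected_of_eventuallyEq (𝕜 := ℂ) (f := f) (g := g)
    (fun b hb => (hball b hb).1) (fun b hb => (hball b hb).2.1) hU hz hev
  exact heq.eventuallyEq_of_mem (Metric.ball_mem_nhds _ hr)

theorem tendsto_ringInverse_one_add_mul_mul
    {A : Type*} [NormedRing A] [CompleteSpace A] {f : A → A} (hf : ContinuousAt f 0) :
    Filter.Tendsto (fun b : A => Ring.inverse (1 + b * f b) * b) (𝓝 0) (𝓝 0) := by
  have h1 : ContinuousAt (fun b : A => 1 + b * f b) 0 :=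
    continuousAt_const.add (continuousAt_id.mul hf)
  have h2 : ContinuousAt Ring.inverse (1 + 0 * f 0) := by
    simpa using NormedRing.inverse_continuousAt (1 : Aˣ)
  have h3 : ContinuousAt (fun b : A => Ring.inverse (1 + b * f b) * b) 0 :=
    (ContinuousAt.comp (f := fun b : A => 1 + b * f b) h2 h1).mul continuousAt_id
  simpa [ContinuousAt] using h3

theorem eventually_isUnit_one_add_mul
    {A : Type*} [NormedRing A] [CompleteSpace A] {f : A → A} (hf : ContinuousAt f 0) :
    ∀ᶠ b in 𝓝 (0 : A), IsUnit (1 + b * f b) := by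
  have h1 : ContinuousAt (fun b : A => 1 + b * f b) 0 :=
    continuousAt_const.add (continuousAt_id.mul hf)
  exact h1.eventually (Units.isOpen.mem_nhds (by simp))

section Resolvent

variable {A E : Type*} [NormedRing A] [NormedAlgebra ℂ A] [NormedAddCommGroup E] [NormedSpace ℂ E]
  [CompleteSpace E]

theorem eventually_isUnit_one_sub_mul (Λ : A →L[ℂ] E →L[ℂ] E) (X : E →L[ℂ] E) :
    ∀ᶠ c in 𝓝 (0 : A), IsUnit (1 - Λ c * X) := by
  have h1 : Continuous fun c : A => 1 - Λ c * X := by fun_prop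
  exact h1.continuousAt.eventually (Units.isOpen.mem_nhds (by simp))

/-- The Cauchy-type transform `c ↦ P ((1 - Λ c X)⁻¹ Λ c Ω)` is tangent to the identity at `0`. -/
theorem hasStrictFDerivAt_resolvent (Λ : A →L[ℂ] E →L[ℂ] E) (X : E →L[ℂ] E) (Ω : E)
    (P : E →L[ℂ] A) (hPΩ : ∀ b, P (Λ b Ω) = b) :
    HasStrictFDerivAt (fun c => P (Ring.inverse (1 - Λ c * X) (Λ c Ω)))
      ((ContinuousLinearEquiv.refl ℂ A : A ≃L[ℂ] A) : A →L[ℂ] A) 0 := by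
  have hT : AnalyticAt ℂ (fun c : A => 1 - Λ c * X) 0 :=
    analyticAt_const.sub ((Λ.analyticAt 0).mul analyticAt_const)
  have hinv : AnalyticAt ℂ (fun c : A => Ring.inverse (1 - Λ c * X)) 0 := by
    refine AnalyticAt.fun_comp (g := Ring.inverse) ?_ hT
    simpa using analyticAt_inverse (𝕜 := ℂ) (1 : (E →L[ℂ] E)ˣ)
  have hΩ : HasStrictFDerivAt (fun c : A => Λ c Ω) (Λ.flip Ω) 0 :=
    (Λ.flip Ω).hasStrictFDerivAt
  convert! P.hasStrictFDerivAt.comp (0 : A) (hinv.hasStrictFDerivAt.clm_apply hΩ) using 1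
  ext h
  simp [hPΩ]

/-- If `Fn` describes the action of `X` on the solutions of `v = Λ b L v + Λ b Ω`, then any
analytic solution `R` of the functional equation of the R-transform of `X` agrees with `Fn`
near `0`. -/
theorem eventually_eq_of_resolvent (Λ : B →L[ℂ] E →L[ℂ] E)
    (hmul : ∀ a b, Λ (a * b) = Λ a * Λ b) (hone : Λ 1 = 1) (L X : E →L[ℂ] E) (Ω : E)
    (P : E →L[ℂ] B) (hPΩ : ∀ b, P (Λ b Ω) = b) (hPL : ∀ b v, P (Λ b (L v)) = 0)
    {R Fn : B → B} (hR : AnalyticAt ℂ R 0) (hFn : AnalyticAt ℂ Fn 0)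
    (hX : ∀ b v, v = Λ b (L v) + Λ b Ω → X v = L v + Λ (Fn b) v)
    (hu : ∀ᶠ b in 𝓝 (0 : B), IsUnit b → ∃ u,
      u = Λ (Ring.inverse (1 + b * R b) * b) (X u) + Λ (Ring.inverse (1 + b * R b) * b) Ω ∧
        P u = b) :
    ∀ᶠ b in 𝓝 (0 : B), R b = Fn b := by
  refine AnalyticAt.eventuallyEq_of_forall_isUnit hR hFn ?_
  have hsolve : ∀ (c : B) (Y : E →L[ℂ] E), IsUnit (1 - Λ c * Y) → ∀ u,
      u = Λ c (Y u) + Λ c Ω ↔ Ring.inverse (1 - Λ c * Y) (Λ c Ω) = u := by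
    intro c Y hc u
    have hsub : ∀ x, (1 - Λ c * Y) x = x - Λ c (Y x) := fun x => rfl
    constructor
    · intro h
      rw [← sub_eq_iff_eq_add', ← hsub] at h
      rw [← h]
      exact DFunLike.congr_fun (Ring.inverse_mul_cancel _ hc) u
    · rintro rfl
      rw [← sub_eq_iff_eq_add', ← hsub]
      exact DFunLike.congr_fun (Ring.mul_inverse_cancel _ hc) (Λ c Ω)
  have hinj := (hasStrictFDerivAt_resolvent Λ X Ω P hPΩ).eventually_left_inverse
  have hunitX := eventually_isUnit_one_sub_mul Λ X
  have hcR := tendsto_ringInverse_one_add_mul_mul hR.continuousAt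
  have hcF := tendsto_ringInverse_one_add_mul_mul hFn.continuousAt
  filter_upwards [hu, eventually_isUnit_one_add_mul hR.continuousAt,
    eventually_isUnit_one_add_mul hFn.continuousAt, hcR.eventually hinj, hcF.eventually hinj,
    hcR.eventually hunitX, hcF.eventually hunitX, eventually_isUnit_one_sub_mul Λ L]
    with b hub hpR hpF hiR hiF hxR hxF hL hb
  obtain ⟨u, hu, hPu⟩ := hub hb
  rw [hsolve _ _ hxR] at hu
  obtain ⟨v, hv⟩ : ∃ v, v = Λ b (L v) + Λ b Ω := ⟨_, (hsolve b L hL _).2 rfl⟩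
  have hPv : P v = b := by rw [hv, map_add, hPL, hPΩ, zero_add]
  have hmul_apply : ∀ a c x, Λ (a * c) x = Λ a (Λ c x) := fun a c x => by rw [hmul]; rfl
  have hone_apply : ∀ x, Λ 1 x = x := fun x => by rw [hone]; rfl
  have hv' : v = Λ (Ring.inverse (1 + b * Fn b) * b) (X v)
      + Λ (Ring.inverse (1 + b * Fn b) * b) Ω := by
    have h1 : Λ (1 + b * Fn b) v = Λ b (X v) + Λ b Ω := by
      rw [hX b v hv, map_add Λ, add_apply, hone_apply, hmul_apply, map_add]
      nth_rewrite 1 [hv]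
      abel
    rw [hmul_apply, hmul_apply, ← map_add, ← h1, ← hmul_apply, Ring.inverse_mul_cancel _ hpF,
      hone_apply]
  rw [hsolve _ _ hxF] at hv'
  have hc : Ring.inverse (1 + b * R b) * b = Ring.inverse (1 + b * Fn b) * b := by
    rw [← hiR, ← hiF, hu, hv', hPu, hPv]
  have hinv := hb.mul_right_cancel hc
  obtain ⟨p, hp⟩ := hpR
  obtain ⟨q, hq⟩ := hpF
  rw [← hp, ← hq, Ring.inverse_unit, Ring.inverse_unit, Units.val_inj, inv_inj] at hinv
  rw [hinv, hq] at hp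
  exact (hb.mul_left_cancel (add_left_cancel hp)).symm

end Resolvent

namespace FockSetup

variable (S : FockSetup B I F)

theorem clm_ext {G : Type*} [NormedAddCommGroup G] [NormedSpace ℂ G] {T U : F →L[ℂ] G}
    (hΩ : ∀ b, T (S.lam b S.Ω) = U (S.lam b S.Ω))
    (hτ : ∀ k d b, T (S.τ k d b) = U (S.τ k d b)) : T = U := by
  refine ContinuousLinearMap.ext_on S.dense_span ?_
  rintro x (⟨b, rfl⟩ | ⟨k, d, b, rfl⟩)
  · exact hΩ b
  · exact hτ k d b

theorem lam_mul_apply (a b : B) (x : F) : S.lam (a * b) x = S.lam a (S.lam b x) := by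
  rw [map_mul]; rfl

theorem P_lam_L (i : I) (b : B) (x : F) : S.P (S.lam b (S.L i x)) = 0 := by
  have h : (S.P.comp ((S.lam b).comp (S.L i))) = 0 := by
    refine S.clm_ext (fun b' => ?_) fun k d b' => ?_
    · simp [L_omega, lam_tensor, P_tensor]
    · simp [L_tensor, lam_tensor, P_tensor]
  exact DFunLike.congr_fun h x

theorem tau_congr {k m : ℕ} (h : k = m) {d : Fin (k + 1) → D B I} {d' : Fin (m + 1) → D B I}
    (b : B) (hd : ∀ (j : Fin (k + 1)) (j' : Fin (m + 1)), (j : ℕ) = j' → d j = d' j') :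
    S.τ k d b = S.τ m d' b := by
  subst h
  rw [show d = d' from funext fun j => hd j j rfl]

theorem lsmul_apply (b : B) (d : D B I) (i : I) : lsmul B I b d i = b * d i := rfl

theorem delta_apply_self (i : I) : delta B I i i = 1 := by
  simp [delta]

/-- `(λ(b) L_i)ⁿ` prepends `n` tensor factors with `i`-th coordinate `b`. -/
theorem pow_lam_L_tau (i : I) (b : B) (n m : ℕ) (d : Fin (m + 1) → D B I) (b₀ : B) :
    ∃ (k : ℕ) (d' : Fin (k + 1) → D B I), k = n + m ∧
      ((S.lam b * S.L i) ^ n) (S.τ m d b₀) = S.τ k d' b₀ ∧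
      (∀ j : Fin (k + 1), (j : ℕ) < n → d' j i = b) ∧
      ∀ (j : Fin (m + 1)) (j' : Fin (k + 1)), (j' : ℕ) = n + j → d' j' = d j := by
  induction n with
  | zero =>
    refine ⟨m, d, by simp, rfl, by simp, fun j j' h => ?_⟩
    rw [show j' = j from Fin.ext (by simpa using h)]
  | succ n ih =>
    obtain ⟨k, d', hk, hpow, hlt, hge⟩ := ih
    refine ⟨k + 1, Function.update (Fin.cons (delta B I i) d' : Fin (k + 1 + 1) → D B I) 0
      (lsmul B I b (delta B I i)), by omega, ?_, ?_, ?_⟩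
    · rw [pow_succ', mul_apply_eq_comp, hpow, mul_apply_eq_comp, L_tensor, lam_tensor]
      rfl
    · intro j hj
      induction j using Fin.cases with
      | zero => simp [lsmul_apply, delta_apply_self]
      | succ j =>
        rw [Function.update_of_ne (Fin.succ_ne_zero j), Fin.cons_succ]
        exact hlt j (by simpa using hj)
    · intro j j' hj'
      induction j' using Fin.cases with
      | zero => simp at hj'; omega
      | succ j' =>
        rw [Function.update_of_ne (Fin.succ_ne_zero j'), Fin.cons_succ]
        exact hge j j' (by simp at hj'; omega)

theorem pow_lam_L_omega (i : I) (b : B) (n : ℕ) (b₀ : B) :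
    ∃ d : Fin (n + 1) → D B I, (∀ j, d j i = b) ∧
      ((S.lam b * S.L i) ^ (n + 1)) (S.lam b₀ S.Ω) = S.τ n d b₀ := by
  obtain ⟨k, d, hk, hpow, hlt, hge⟩ :=
    S.pow_lam_L_tau i b n 0 (Function.update (fun _ => delta B I i) 0
      (lsmul B I b (delta B I i))) b₀
  obtain rfl : k = n := by simpa using hk
  refine ⟨d, fun j => ?_, ?_⟩
  · rcases (Nat.lt_succ_iff.1 j.2).lt_or_eq with h | h
    · exact hlt j h
    · rw [hge 0 j (by simpa using h)]
      simp [lsmul_apply, delta_apply_self]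
  · rw [← hpow, pow_succ, mul_apply_eq_comp, mul_apply_eq_comp, L_omega, lam_tensor]

theorem V_mul_pow_lam_L (i : I) (n : ℕ) (α : ContinuousMultilinearMap ℂ (fun _ : Fin n => B) B)
    (b : B) : S.V i n α * (S.lam b * S.L i) ^ n = S.lam (α fun _ => b) := by
  cases n with
  | zero => rw [pow_zero, mul_one, V_zero]; congr 2; exact Subsingleton.elim _ _
  | succ n =>
    refine S.clm_ext (fun b₀ => ?_) fun m d b₀ => ?_
    · obtain ⟨d, hd, hpow⟩ := S.pow_lam_L_omega i b n b₀
      rw [mul_apply_eq_comp, hpow, V_tensor_eq, ← lam_mul_apply]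
      simp only [hd]
    · obtain ⟨k, d', hk, hpow, hlt, hge⟩ := S.pow_lam_L_tau i b (n + 1) m d b₀
      rw [mul_apply_eq_comp, hpow, V_tensor_gt _ _ _ (by omega) _ _ _ _ (by omega)]
      congr 1
      · congr 2
        funext j
        exact hlt _ j.2
      · refine S.tau_congr (by omega) b₀ fun j j' h => hge _ _ ?_
        simp [h]

theorem V_pow_lam_L_omega_of_lt (i : I) {n k : ℕ} (hk : k < n)
    (α : ContinuousMultilinearMap ℂ (fun _ : Fin n => B) B) (b b₀ : B) :
    S.V i n α (((S.lam b * S.L i) ^ k) (S.lam b₀ S.Ω)) = 0 := by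
  cases k with
  | zero => exact S.V_omega i n hk α b₀
  | succ k =>
    obtain ⟨d, -, hpow⟩ := S.pow_lam_L_omega i b k b₀
    rw [hpow, V_tensor_lt _ _ _ _ _ _ _ hk]

/-- Vectors depending on `b : B` through finitely many elementary tensors whose entries are
coordinatewise continuous in `b`. -/
inductive Regular : (B → F) → Prop
  | omega (g : B → B) (hg : Continuous g) : Regular fun b => S.lam (g b) S.Ω
  | tensor (k : ℕ) (d : B → Fin (k + 1) → D B I) (hd : ∀ j i, Continuous fun b => d b j i)
      (g : B → B) (hg : Continuous g) : Regular fun b => S.τ k (d b) (g b)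
  | add (f g : B → F) (hf : Regular f) (hg : Regular g) : Regular fun b => f b + g b

/-- Operators mapping regular families of vectors to regular families. -/
def PreservesRegular (T : F →L[ℂ] F) : Prop :=
  ∀ f, S.Regular f → S.Regular fun b => T (f b)

variable {S}

theorem Regular.zero : S.Regular fun _ => 0 := by
  simpa using Regular.omega (S := S) (fun _ => 0) continuous_const

theorem Regular.lam {f : B → F} (hf : S.Regular f) {a : B → B} (ha : Continuous a) :
    S.Regular fun b => S.lam (a b) (f b) := by
  induction hf with
  | omega g hg =>
    simp only [← lam_mul_apply]
    exact .omega _ (ha.mul hg)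
  | tensor k d hd g hg =>
    simp only [lam_tensor]
    refine .tensor k _ (fun j i => ?_) g hg
    by_cases hj : j = 0
    · subst hj
      simp only [Function.update_self, lsmul_apply]
      exact ha.mul (hd 0 i)
    · simpa [Function.update_of_ne hj] using hd j i
  | add f g _ _ hf hg => simpa using hf.add _ _ hg

theorem Regular.continuous_P {f : B → F} (hf : S.Regular f) : Continuous fun b => S.P (f b) := by
  induction hf with
  | omega g hg => simpa [P_lam_omega] using hg
  | tensor k d hd g hg => simpa [P_tensor] using continuous_const
  | add f g _ _ hf hg =>
    simp only [map_add]
    exact hf.add hg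

variable (S)

theorem preservesRegular_one : S.PreservesRegular 1 := fun _ hf => hf

theorem preservesRegular_lam (a : B) : S.PreservesRegular (S.lam a) :=
  fun _ hf => hf.lam continuous_const

theorem preservesRegular_L (i : I) : S.PreservesRegular (S.L i) := by
  intro f hf
  induction hf with
  | omega g hg =>
    simp only [L_omega]
    exact .tensor 0 _ (fun _ _ => continuous_const) g hg
  | tensor k d hd g hg =>
    simp only [L_tensor]
    refine .tensor (k + 1) _ (fun j i' => ?_) g hg
    induction j using Fin.cases with
    | zero => simpa using continuous_const
    | succ j => simpa using hd j i'
  | add f g _ _ hf hg => simpa using hf.add _ _ hg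

theorem preservesRegular_V (i : I) (n : ℕ)
    (α : ContinuousMultilinearMap ℂ (fun _ : Fin n => B) B) : S.PreservesRegular (S.V i n α) := by
  cases n with
  | zero => rw [V_zero]; exact S.preservesRegular_lam _
  | succ n =>
    intro f hf
    induction hf with
    | omega g hg => simpa [V_omega] using Regular.zero
    | tensor k d hd g hg =>
      rcases lt_trichotomy (k + 1) (n + 1) with h | h | h
      · simpa [V_tensor_lt _ _ _ _ _ _ _ h] using Regular.zero
      · obtain rfl : k = n := by omega
        simp only [V_tensor_eq]
        exact .omega _ ((α.cont.comp (continuous_pi fun j => hd j i)).mul hg)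
      · have h' : n + 1 ≤ k := by omega
        simp only [V_tensor_gt S i (n + 1) (by omega) α k _ _ h']
        exact (Regular.tensor (k - (n + 1)) _ (fun j i => hd _ i) g hg).lam
          (α.cont.comp (continuous_pi fun j => hd _ i))
    | add f g _ _ hf hg => simpa using hf.add _ _ hg

variable {S}

theorem PreservesRegular.add {T U : F →L[ℂ] F} (hT : S.PreservesRegular T)
    (hU : S.PreservesRegular U) : S.PreservesRegular (T + U) :=
  fun f hf => (hT f hf).add _ _ (hU f hf)

theorem PreservesRegular.mul {T U : F →L[ℂ] F} (hT : S.PreservesRegular T)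
    (hU : S.PreservesRegular U) : S.PreservesRegular (T * U) :=
  fun f hf => hT _ (hU f hf)

theorem PreservesRegular.sum {ι : Type*} (s : Finset ι) {T : ι → F →L[ℂ] F}
    (hT : ∀ n ∈ s, S.PreservesRegular (T n)) : S.PreservesRegular (∑ n ∈ s, T n) :=
  Finset.sum_induction T S.PreservesRegular (fun _ _ => PreservesRegular.add)
    (fun _ _ => Regular.zero) hT

variable (S)

/-- The vectors that cannot be detected by `P` and the operators preserving regular families. -/
def regularNull : Submodule ℂ F :=
  ⨅ T : {T : F →L[ℂ] F // S.PreservesRegular T}, (S.P.comp T.1).ker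

theorem mem_regularNull {x : F} :
    x ∈ S.regularNull ↔ ∀ T, S.PreservesRegular T → S.P (T x) = 0 := by
  simp [regularNull]

instance isClosed_regularNull : IsClosed (S.regularNull : Set F) := by
  rw [regularNull, Submodule.coe_iInf]
  exact isClosed_iInter fun T => (S.P.comp T.1).isClosed_ker

variable {S}

theorem PreservesRegular.apply_mem {T : F →L[ℂ] F} (hT : S.PreservesRegular T) {x : F}
    (hx : x ∈ S.regularNull) : T x ∈ S.regularNull :=
  S.mem_regularNull.2 fun U hU => S.mem_regularNull.1 hx (U * T) (hU.mul hT)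

/-- The operator induced on the quotient by `S.regularNull`. -/
def PreservesRegular.quot {T : F →L[ℂ] F} (hT : S.PreservesRegular T) :
    F ⧸ S.regularNull →L[ℂ] F ⧸ S.regularNull :=
  S.regularNull.liftQL (S.regularNull.mkQL.comp T) fun x hx => by
    simpa using hT.apply_mem hx

theorem PreservesRegular.quot_mkQL {T : F →L[ℂ] F} (hT : S.PreservesRegular T) (x : F) :
    hT.quot (S.regularNull.mkQL x) = S.regularNull.mkQL (T x) := rfl

variable (S)

/-- The projection `P` on the quotient by `S.regularNull`. -/
def quotP : F ⧸ S.regularNull →L[ℂ] B :=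
  S.regularNull.liftQL S.P fun _ hx => S.mem_regularNull.1 hx 1 S.preservesRegular_one

theorem quotP_mkQL (x : F) : S.quotP (S.regularNull.mkQL x) = S.P x := rfl

/-- The left action of `B` on the quotient by `S.regularNull`, as a linear map. -/
def quotLamAux : B →ₗ[ℂ] (F ⧸ S.regularNull →L[ℂ] F ⧸ S.regularNull) where
  toFun b := (S.preservesRegular_lam b).quot
  map_add' a b := by
    ext x
    obtain ⟨x, rfl⟩ := S.regularNull.mkQ_surjective x
    change S.regularNull.mkQL (S.lam (a + b) x) =
      S.regularNull.mkQL (S.lam a x) + S.regularNull.mkQL (S.lam b x)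
    rw [map_add, add_apply, map_add]
  map_smul' z b := by
    ext x
    obtain ⟨x, rfl⟩ := S.regularNull.mkQ_surjective x
    change S.regularNull.mkQL (S.lam (z • b) x) = z • S.regularNull.mkQL (S.lam b x)
    rw [map_smul, smul_apply, map_smul]

theorem quotLamAux_mkQL (b : B) (x : F) :
    S.quotLamAux b (S.regularNull.mkQL x) = S.regularNull.mkQL (S.lam b x) := rfl

theorem continuous_quotLamAux : Continuous S.quotLamAux := by
  refine LinearMap.continuous_of_seq_closed_graph (𝕜 := ℂ) (E := B)
    (F := F ⧸ S.regularNull →L[ℂ] F ⧸ S.regularNull) (g := S.quotLamAux) fun u b T hu hT => ?_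
  have key : ∀ x, (S.Regular fun b => S.lam b x) →
      (T.comp S.regularNull.mkQL) x = ((S.quotLamAux b).comp S.regularNull.mkQL) x := by
    intro x hx
    obtain ⟨y, hy⟩ := S.regularNull.mkQ_surjective (T (S.regularNull.mkQL x))
    have hTx : Filter.Tendsto (fun n => S.regularNull.mkQL (S.lam (u n) x)) Filter.atTop
        (𝓝 (S.regularNull.mkQL y)) := by
      rw [Submodule.mkQL_apply _ y, hy]
      exact ((ContinuousLinearMap.apply ℂ (F ⧸ S.regularNull)
        (S.regularNull.mkQL x)).continuous.tendsto T).comp hT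
    have hmem : y - S.lam b x ∈ S.regularNull := by
      refine S.mem_regularNull.2 fun U hU => ?_
      have h1 := ((S.quotP.comp hU.quot).continuous.tendsto _).comp hTx
      have h2 := ((hU _ hx).continuous_P.tendsto b).comp hu
      rw [map_sub, map_sub, sub_eq_zero]
      exact tendsto_nhds_unique h1 h2
    rw [ContinuousLinearMap.comp_apply, ContinuousLinearMap.comp_apply, quotLamAux_mkQL, ← hy,
      ← Submodule.mkQL_apply]
    exact (Submodule.Quotient.eq _).2 hmem
  have h : T.comp S.regularNull.mkQL = (S.quotLamAux b).comp S.regularNull.mkQL :=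
    S.clm_ext
      (fun b₀ => key _ (Regular.lam (.omega (fun _ => b₀) continuous_const) continuous_id))
      (fun k d b₀ => key _ (Regular.lam (.tensor k (fun _ => d) (fun _ _ => continuous_const)
        (fun _ => b₀) continuous_const) continuous_id))
  ext x
  obtain ⟨x, rfl⟩ := S.regularNull.mkQ_surjective x
  exact DFunLike.congr_fun h x

/-- The left action of `B` on the quotient by `S.regularNull`. -/
def quotLam : B →L[ℂ] (F ⧸ S.regularNull →L[ℂ] F ⧸ S.regularNull) :=
  ⟨S.quotLamAux, S.continuous_quotLamAux⟩

theorem quotLam_mkQL (b : B) (x : F) :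
    S.quotLam b (S.regularNull.mkQL x) = S.regularNull.mkQL (S.lam b x) := rfl

theorem V_sub_lam_mem_regularNull (i : I) (n : ℕ)
    (α : ContinuousMultilinearMap ℂ (fun _ : Fin n => B) B) (b b₀ : B) {v : F}
    (hv : v - (S.lam b (S.L i v) + S.lam b₀ S.Ω) ∈ S.regularNull) :
    S.V i n α v - S.lam (α fun _ => b) v ∈ S.regularNull := by
  set T := S.lam b * S.L i with hT
  have hTpres : S.PreservesRegular T := (S.preservesRegular_lam b).mul (S.preservesRegular_L i)
  have hpow : ∀ k : ℕ, S.PreservesRegular (T ^ k) := by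
    intro k
    induction k with
    | zero => exact S.preservesRegular_one
    | succ k ih => rw [pow_succ]; exact ih.mul hTpres
  have hgeom : ∀ m : ℕ,
      v - ((T ^ m) v + ∑ k ∈ Finset.range m, (T ^ k) (S.lam b₀ S.Ω)) ∈ S.regularNull := by
    intro m
    induction m with
    | zero => simp
    | succ m ih =>
      have := S.regularNull.add_mem ih ((hpow m).apply_mem hv)
      convert this using 1
      rw [Finset.sum_range_succ, pow_succ, mul_apply_eq_comp, map_sub, map_add, hT,
        mul_apply_eq_comp]
      abel
  have h := (S.preservesRegular_V i n α).apply_mem (hgeom n)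
  rw [map_sub, map_add, map_sum, Finset.sum_eq_zero fun k hk =>
    S.V_pow_lam_L_omega_of_lt i (Finset.mem_range.1 hk) α b b₀, add_zero,
    ← mul_apply_eq_comp, S.V_mul_pow_lam_L] at h
  exact h

end FockSetup

/-- Lemma 4.5: for `X = L₁ + ∑_{n=0}^{N} V_{1,n}(αₙ)` (the index `1 ∈ {1,2}` is `0 : Fin 2`)
and `F(b) = α₀ + ∑_{n=1}^N αₙ(b,…,b)`, the R-transform of `X` is `R_X(b) = F(b)`. -/
theorem stmt_17 (S : FockSetup B (Fin 2) F) (N : ℕ) (hN : 1 ≤ N)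
    (α : (n : ℕ) → ContinuousMultilinearMap ℂ (fun _ : Fin n => B) B)
    (X : F →L[ℂ] F)
    (hX : X = S.L 0 + ∑ n ∈ Finset.range (N + 1), S.V 0 n (α n)) :
    ∀ R : B → B, S.IsRTransform X R →
      ∀ᶠ b in nhds (0 : B), R b = ∑ n ∈ Finset.range (N + 1), α n (fun _ => b) := by
  rintro R ⟨hR, hC⟩
  have hXpres : S.PreservesRegular X := by
    rw [hX]
    exact (S.preservesRegular_L 0).add (.sum _ fun n _ => S.preservesRegular_V 0 n (α n))
  have hsurj := S.regularNull.mkQ_surjective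
  refine eventually_eq_of_resolvent S.quotLam (fun a b => ?_) ?_ (S.preservesRegular_L 0).quot
    hXpres.quot (S.regularNull.mkQL S.Ω) S.quotP (fun b => ?_) (fun b v => ?_) hR ?_
    (fun b v hv => ?_) ?_
  · ext x
    obtain ⟨x, rfl⟩ := hsurj x
    exact congrArg S.regularNull.mkQL (S.lam_mul_apply a b x)
  · ext x
    obtain ⟨x, rfl⟩ := hsurj x
    change S.regularNull.mkQL (S.lam 1 x) = S.regularNull.mkQL x
    rw [map_one, one_apply_eq_self]
  · exact S.P_lam_omega b
  · obtain ⟨v, rfl⟩ := hsurj v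
    exact S.P_lam_L 0 b v
  · refine Finset.analyticAt_fun_sum _ fun n _ => ?_
    exact (α n).analyticAt.fun_comp ((ContinuousLinearMap.pi fun _ : Fin n =>
      ContinuousLinearMap.id ℂ B).analyticAt 0)
  · obtain ⟨v, rfl⟩ := hsurj v
    have hv' : v - (S.lam b (S.L 0 v) + S.lam b S.Ω) ∈ S.regularNull :=
      (Submodule.Quotient.eq _).1 hv
    refine (Submodule.Quotient.eq _).2 ?_
    have := S.regularNull.sum_mem fun n (_ : n ∈ Finset.range (N + 1)) =>
      S.V_sub_lam_mem_regularNull 0 n (α n) b b hv'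
    convert this using 1
    change X v - (S.L 0 v + S.lam (∑ n ∈ Finset.range (N + 1), α n fun _ => b) v) = _
    rw [Finset.sum_sub_distrib, hX, add_apply, map_sum, sum_apply, sum_apply,
      add_sub_add_left_eq_sub]
  · filter_upwards [hC] with b hb hunit
    set c := Ring.inverse (1 + b * R b) * b with hc
    rw [FockSetup.Ca, FockSetup.Ec, mul_apply_eq_comp] at hb
    refine ⟨S.regularNull.mkQL (Ring.inverse (1 - S.lam c * X) (S.lam c S.Ω)), ?_, hb⟩
    rw [FockSetup.PreservesRegular.quot_mkQL, S.quotLam_mkQL, S.quotLam_mkQL, ← map_add]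
    congr 1
    by_cases hu : IsUnit (1 - S.lam c * X)
    · have := DFunLike.congr_fun (Ring.mul_inverse_cancel _ hu) (S.lam c S.Ω)
      exact sub_eq_iff_eq_add'.1 this
    · rw [Ring.inverse_non_unit _ hu] at hb ⊢
      have hb0 : b = 0 := by simpa using hb.symm
      have hc0 : c = 0 := by rw [hc, hb0, mul_zero]
      exact absurd (by simp [hc0]) hu
end
end

section
/- Let B be a unital complex Banach algebra, take I = {1,2} in the Fock-space construction, let N ≥ 1, choose α₀, β₀ ∈ B and bounded n-multilinear maps α_n, β_n : Bⁿ → B for n ∈ {1,…,N}, and set F(b) = α₀ + Σ_{n=1}^{N} α_n(b,…,b) and G(b) = β₀ + Σ_{n=1}^{N} β_n(b,…,b). Let X = L₁ + Σ_{n=0}^{N} V_{1,n}(α_n) and Y = L₂ + Σ_{n=0}^{N} V_{2,n}(β_n) in B(𝔉). Then, with respect to the expectation ℰ, the R-transform of X+Y satisfies R_{X+Y}(b) = F(b) + G(b) = R_X(b) + R_Y(b) for all b in a neighborhood of 0 in B. -/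
open scoped Topology ENNReal

noncomputable section

variable (B : Type*) [NormedRing B] [NormedAlgebra ℂ B] [CompleteSpace B]
variable (I : Type*) [DecidableEq I]

variable {B} {I}
variable {F : Type*} [NormedAddCommGroup F] [NormedSpace ℂ F] [CompleteSpace F]

set_option linter.unusedSectionVars false

namespace FockSetup

section Words

variable {ι : Type*} (S : FockSetup B I F) (e : ι → I) (b : B)

/-- The vector `bδ_{w 0} ⊗ ⋯ ⊗ bδ_{w (k-1)} ⊗ b`. -/
def word : (k : ℕ) → (Fin k → ι) → F
  | 0, _ => S.lam b S.Ω
  | k + 1, w => S.τ k (fun j => lsmul B I b (delta B I (e (w j)))) b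

lemma lam_L_word (i : ι) {k : ℕ} (w : Fin k → ι) :
    S.lam b (S.L (e i) (S.word e b k w)) = S.word e b (k + 1) (Fin.cons i w) := by
  cases k with
  | zero =>
    simp only [word, S.L_omega, S.lam_tensor]
    congr 1
    funext j
    obtain rfl : j = 0 := Fin.fin_one_eq_zero j
    simp
  | succ k =>
    simp only [word, S.L_tensor, S.lam_tensor]
    congr 1
    funext j
    refine Fin.cases ?_ (fun j => ?_) j <;> simp

lemma pow_apply_omega [Fintype ι] (k : ℕ) :
    ((S.lam b * ∑ j, S.L (e j)) ^ k) (S.lam b S.Ω) = ∑ w : Fin k → ι, S.word e b k w := by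
  induction k with
  | zero => simp [word]
  | succ k ih =>
    rw [pow_succ', mul_apply_eq_comp, ih, map_sum]
    simp only [mul_apply_eq_comp, sum_apply, map_sum,
      lam_L_word]
    rw [Finset.sum_comm, ← Fintype.sum_prod_type',
      ← (Fin.consEquiv fun _ : Fin (k + 1) => ι).sum_comp]
    rfl

lemma P_word_succ (k : ℕ) (w : Fin (k + 1) → ι) : S.P (S.word e b (k + 1) w) = 0 :=
  S.P_tensor _ _ _

lemma V_word_lt (i : I) {n k : ℕ} (h : k < n)
    (a : ContinuousMultilinearMap ℂ (fun _ : Fin n => B) B) (w : Fin k → ι) :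
    S.V i n a (S.word e b k w) = 0 := by
  cases k with
  | zero => exact S.V_omega i n h a b
  | succ k => exact S.V_tensor_lt i n a k _ b h

lemma τ_congr {p q : ℕ} (h : p = q) {d : Fin (p + 1) → D B I} {d' : Fin (q + 1) → D B I}
    (hd : ∀ j, d j = d' (Fin.cast (by rw [h]) j)) (b₀ : B) : S.τ p d b₀ = S.τ q d' b₀ := by
  subst h
  congr 1
  funext j
  exact hd j

lemma V_word_append (i : I) {n m : ℕ}
    (a : ContinuousMultilinearMap ℂ (fun _ : Fin (n + 1) => B) B)
    (w : Fin (n + 1) → ι) (w' : Fin m → ι) :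
    S.V i (n + 1) a (S.word e b (n + 1 + m) (Fin.append w w')) =
      S.lam (a fun j => b * delta B I (e (w j)) i) (S.word e b m w') := by
  cases m with
  | zero =>
    have h := S.V_tensor_eq i n a (fun j => lsmul B I b (delta B I (e (w j)))) b
    have hw : Fin.append w w' = w := by
      funext j
      exact Fin.append_left w w' j
    rw [hw]
    simp only [word]
    refine h.trans ?_
    rw [map_mul]
    rfl
  | succ m =>
    have h := S.V_tensor_gt i (n + 1) (by omega) a (n + 1 + m)
      (fun j => lsmul B I b (delta B I (e (Fin.append w w' j)))) b (by omega)
    refine h.trans ?_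
    simp only [word]
    congr 1
    · congr 2
      funext j
      have : Fin.append w w' (Fin.castLE (by omega) j) = w j := Fin.append_left w w' j
      rw [this]
      rfl
    · refine S.τ_congr (by omega) (fun j => ?_) b
      have : Fin.append w w' ⟨n + 1 + (j : ℕ), by omega⟩ = w' (Fin.cast (by congr 1; omega) j) :=
        Fin.append_right w w' (Fin.cast (by congr 1; omega) j)
      rw [this]

lemma sum_delta_apply [Fintype ι] {e : ι → I} (he : Function.Injective e) (i : ι) :
    ∑ j, b * delta B I (e j) (e i) = b := by
  rw [Finset.sum_eq_single i]
  · simp [delta]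
  · intro j _ hj
    have : e i ≠ e j := fun h => hj (he h).symm
    simp [delta, lp.single_apply, this]
  · simp

lemma V_pow_lt [Fintype ι] (i : I) {n k : ℕ} (h : k < n)
    (a : ContinuousMultilinearMap ℂ (fun _ : Fin n => B) B) :
    S.V i n a (((S.lam b * ∑ j, S.L (e j)) ^ k) (S.lam b S.Ω)) = 0 := by
  rw [pow_apply_omega, map_sum]
  exact Finset.sum_eq_zero fun w _ => S.V_word_lt e b i h a w

lemma V_pow_add [Fintype ι] {e : ι → I} (he : Function.Injective e) (i : ι) (n m : ℕ)
    (a : ContinuousMultilinearMap ℂ (fun _ : Fin n => B) B) :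
    S.V (e i) n a (((S.lam b * ∑ j, S.L (e j)) ^ (m + n)) (S.lam b S.Ω)) =
      S.lam (a fun _ => b) (((S.lam b * ∑ j, S.L (e j)) ^ m) (S.lam b S.Ω)) := by
  classical
  cases n with
  | zero =>
    rw [S.V_zero, Subsingleton.elim (fun _ => b) (0 : Fin 0 → B), add_zero]
  | succ n =>
    have hb : a (fun _ => b) =
        ∑ w : Fin (n + 1) → ι, a fun j => b * delta B I (e (w j)) (e i) := by
      have h := a.toMultilinearMap.map_sum fun (_ : Fin (n + 1)) j => b * delta B I (e j) (e i)
      simp only [sum_delta_apply b he i] at h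
      exact h
    rw [add_comm m (n + 1), pow_apply_omega, pow_apply_omega, hb,
      ← (Fin.appendEquiv (n + 1) m).sum_comp, Fintype.sum_prod_type]
    simp only [map_sum, sum_apply]
    rw [Finset.sum_comm]
    refine Finset.sum_congr rfl fun w' _ => Finset.sum_congr rfl fun w _ => ?_
    exact S.V_word_append (e := e) b (e i) a w w'

end Words

section Model

variable {ι : Type*} [Fintype ι] (S : FockSetup B I F) (e : ι → I) (N : ℕ)
  (a : ι → (n : ℕ) → ContinuousMultilinearMap ℂ (fun _ : Fin n => B) B)

/-- The operator `∑ⱼ (L_{e j} + ∑ₙ V_{e j, n}(a j n))`. -/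
def modelOp : F →L[ℂ] F :=
  ∑ j, (S.L (e j) + ∑ n ∈ Finset.range (N + 1), S.V (e j) n (a j n))

/-- The function `b ↦ ∑ⱼ ∑ₙ a j n (b, …, b)`. -/
def modelR (b : B) : B := ∑ j, ∑ n ∈ Finset.range (N + 1), a j n fun _ => b

lemma analyticAt_modelR (b : B) : AnalyticAt ℂ (modelR N a) b := by
  unfold modelR
  refine Finset.analyticAt_fun_sum _ fun j _ => Finset.analyticAt_fun_sum _ fun n _ => ?_
  exact AnalyticAt.fun_comp (g := a j n) (f := fun (b : B) (_ : Fin n) => b) (a j n).analyticAt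
    ((ContinuousLinearMap.pi fun _ : Fin n => ContinuousLinearMap.id ℂ B).analyticAt b)

lemma exists_fixed_vector {e : ι → I} (he : Function.Injective e) (b : B)
    (hb : ‖S.lam b * ∑ j, S.L (e j)‖ < 1) :
    ∃ v : F, S.P v = b ∧
      S.lam b (S.modelOp e N a v) = v - S.lam b S.Ω + S.lam (b * modelR N a b) v := by
  set T := S.lam b * ∑ j, S.L (e j) with hT
  set u := S.lam b S.Ω with hu
  have hs : Summable fun k => T ^ k := summable_geometric_of_norm_lt_one hb
  have hv : HasSum (fun k => (T ^ k) u) ((∑' k, T ^ k) u) :=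
    (ContinuousLinearMap.apply ℂ F u).hasSum hs.hasSum
  generalize (∑' k, T ^ k) u = v at hv
  have hTv : T v = v - u := by
    have h1 : HasSum (fun k => (T ^ (k + 1)) u) (T v) := by
      simpa only [pow_succ', mul_apply_eq_comp] using T.hasSum hv
    have h2 := (hasSum_nat_add_iff' 1).2 hv
    simpa using h1.unique h2
  have hV : ∀ j n, S.V (e j) n (a j n) v = S.lam (a j n fun _ => b) v := by
    intro j n
    have h1 := (S.lam (a j n fun _ => b)).hasSum hv
    have h2 := (hasSum_nat_add_iff' n).2 ((S.V (e j) n (a j n)).hasSum hv)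
    rw [Finset.sum_eq_zero fun k hk => S.V_pow_lt e b (e j) (Finset.mem_range.1 hk) (a j n),
      sub_zero] at h2
    simp only [hT, hu, S.V_pow_add b he j n _ (a j n)] at h1 h2
    exact h2.unique h1
  refine ⟨v, ?_, ?_⟩
  · have h1 := S.P.hasSum hv
    refine h1.unique ?_
    have h0 : S.P ((T ^ 0) u) = b := by simp [hu, S.P_lam_omega]
    suffices h : HasSum (fun k => S.P ((T ^ k) u)) (S.P ((T ^ 0) u)) by rwa [h0] at h
    refine hasSum_single 0 fun k hk => ?_
    obtain ⟨k, rfl⟩ := Nat.exists_eq_succ_of_ne_zero hk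
    rw [hT, hu, pow_apply_omega, map_sum]
    exact Finset.sum_eq_zero fun w _ => S.P_word_succ e b k w
  · have h1 : S.modelOp e N a v = (∑ j, S.L (e j)) v + S.lam (modelR N a b) v := by
      simp only [modelOp, modelR, sum_apply, add_apply, hV,
        map_sum, Finset.sum_add_distrib]
    rw [h1, map_add, ← mul_apply_eq_comp, ← mul_apply_eq_comp, ← hT, hTv, map_mul]

/-- The function `b ↦ (1 + b R(b))⁻¹ b` attached to `R`. -/
def invCauchy (R : B → B) (b : B) : B := Ring.inverse (1 + b * R b) * b

lemma Ca_invCauchy_modelR {e : ι → I} (he : Function.Injective e) (b : B)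
    (hb : ‖S.lam b * ∑ j, S.L (e j)‖ < 1) (h1 : IsUnit (1 + b * modelR N a b))
    (h2 : IsUnit (S.lam (1 + b * modelR N a b) - S.lam b * S.modelOp e N a)) :
    S.Ca (S.modelOp e N a) (invCauchy (modelR N a) b) = b := by
  obtain ⟨v, hv, hZ⟩ := S.exists_fixed_vector N a he b hb
  set Z := S.modelOp e N a
  set x := 1 + b * modelR N a b with hx
  have hc : x * invCauchy (modelR N a) b = b := by
    rw [invCauchy, ← mul_assoc, Ring.mul_inverse_cancel _ h1, one_mul]
  set c := invCauchy (modelR N a) b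
  have hfac : S.lam x * (1 - S.lam c * Z) = S.lam x - S.lam b * Z := by
    rw [mul_sub, mul_one, ← mul_assoc, ← map_mul, hc]
  have hux : IsUnit (S.lam x) := h1.map S.lam
  have hunit : IsUnit (1 - S.lam c * Z) := by
    rw [← hfac] at h2
    obtain ⟨y, hy⟩ := hux
    rwa [← hy, Units.isUnit_units_mul] at h2
  have hvc : (1 - S.lam c * Z) v = S.lam c S.Ω := by
    have h3 : S.lam x ((1 - S.lam c * Z) v) = S.lam x (S.lam c S.Ω) := by
      rw [← mul_apply_eq_comp, ← mul_apply_eq_comp, hfac, ← map_mul, hc,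
        sub_apply, mul_apply_eq_comp, hZ, hx, map_add, map_one,
        add_apply, one_apply_eq_self]
      abel
    have hinv : ∀ y, Ring.inverse (S.lam x) (S.lam x y) = y := fun y => by
      rw [← mul_apply_eq_comp, Ring.inverse_mul_cancel _ hux, one_apply_eq_self]
    exact Function.LeftInverse.injective hinv h3
  rw [Ca, Ec, mul_apply_eq_comp, ← hvc, ← mul_apply_eq_comp, Ring.inverse_mul_cancel _ hunit,
    one_apply_eq_self, hv]

/-- The left action is not assumed continuous, so the inverse formula is only obtained near `0`
along each complex line. -/
lemma eventually_Ca_invCauchy_modelR {e : ι → I} (he : Function.Injective e) (b : B) :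
    ∀ᶠ t : ℂ in 𝓝 0,
      S.Ca (S.modelOp e N a) (invCauchy (modelR N a) (t • b)) = t • b := by
  have hcont : ContinuousAt (fun t : ℂ => 1 + t • b * modelR N a (t • b)) 0 := by
    have : ContinuousAt (fun t : ℂ => modelR N a (t • b)) 0 :=
      ContinuousAt.comp (g := modelR N a) (analyticAt_modelR N a _).continuousAt (by fun_prop)
    fun_prop
  have h1 : ∀ᶠ t : ℂ in 𝓝 0, ‖S.lam (t • b) * ∑ j, S.L (e j)‖ < 1 := by
    have : ContinuousAt (fun t : ℂ => ‖S.lam (t • b) * ∑ j, S.L (e j)‖) 0 := by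
      simp only [map_smul, smul_mul_assoc]
      fun_prop
    exact this.eventually_lt_const (by simp)
  have h2 : ∀ᶠ t : ℂ in 𝓝 0, IsUnit (1 + t • b * modelR N a (t • b)) :=
    hcont.eventually_mem (Units.isOpen.mem_nhds (by simp))
  have h3 : ∀ᶠ t : ℂ in 𝓝 0, IsUnit (S.lam (1 + t • b * modelR N a (t • b)) -
      S.lam (t • b) * S.modelOp e N a) := by
    have : ContinuousAt (fun t : ℂ => S.lam (1 + t • b * modelR N a (t • b)) -
        S.lam (t • b) * S.modelOp e N a) 0 := by
      have hsm : ∀ (t : ℂ) j n, a j n (fun _ => t • b) = t ^ n • a j n fun _ => b := by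
        intro t j n
        simpa using (a j n).map_smul_univ (fun _ => t) fun _ => b
      simp only [modelR, hsm, map_add, map_mul, map_sum, map_smul, map_one]
      fun_prop
    exact this.eventually_mem (Units.isOpen.mem_nhds (by simp))
  filter_upwards [h1, h2, h3] with t ht1 ht2 ht3
  exact S.Ca_invCauchy_modelR N a he _ ht1 ht2 ht3

lemma hasStrictFDerivAt_invCauchy {R : B → B} (hR : AnalyticAt ℂ R 0) :
    HasStrictFDerivAt (invCauchy R)
      ((ContinuousLinearEquiv.refl ℂ B : B ≃L[ℂ] B) : B →L[ℂ] B) 0 := by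
  have h1 : AnalyticAt ℂ (fun b => Ring.inverse (1 + b * R b)) 0 := by
    have h2 : AnalyticAt ℂ (fun b => 1 + b * R b) 0 :=
      analyticAt_const.add (analyticAt_id.mul hR)
    refine AnalyticAt.fun_comp (g := Ring.inverse) ?_ h2
    simpa using analyticAt_inverse (𝕜 := ℂ) (1 : Bˣ)
  have h3 := h1.hasStrictFDerivAt.mul' (hasStrictFDerivAt_id (𝕜 := ℂ) (0 : B))
  refine h3.congr_fderiv ?_
  ext x
  simp

lemma eventually_invCauchy_eq {e : ι → I} (he : Function.Injective e) {R : B → B}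
    (hR : S.IsRTransform (S.modelOp e N a) R) (b : B) :
    ∀ᶠ t : ℂ in 𝓝 0, invCauchy R (t • b) = invCauchy (modelR N a) (t • b) := by
  have hinv : ∀ᶠ c in 𝓝 (0 : B), invCauchy R (S.Ca (S.modelOp e N a) c) = c := by
    have hmap := (hasStrictFDerivAt_invCauchy hR.1).map_nhds_eq_of_equiv
    have h0 : invCauchy R 0 = 0 := by simp [invCauchy]
    rw [h0] at hmap
    rw [← hmap, Filter.eventually_map]
    filter_upwards [hR.2] with x hx
    exact congrArg (invCauchy R) hx
  have htend : Filter.Tendsto (fun t : ℂ => invCauchy (modelR N a) (t • b)) (𝓝 0) (𝓝 0) := by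
    have h1 : ContinuousAt (invCauchy (modelR N a)) ((0 : ℂ) • b) := by
      rw [zero_smul]
      exact (hasStrictFDerivAt_invCauchy (analyticAt_modelR N a 0)).continuousAt
    have h2 : ContinuousAt (fun t : ℂ => invCauchy (modelR N a) (t • b)) 0 :=
      ContinuousAt.comp (g := invCauchy (modelR N a)) h1 (by fun_prop)
    simpa [ContinuousAt, invCauchy] using h2
  filter_upwards [htend.eventually hinv, S.eventually_Ca_invCauchy_modelR N a he b]
    with t h1 h2
  rwa [h2] at h1

lemma eventually_eq_of_isUnit {R R' : B → B} (hR : AnalyticAt ℂ R 0) (hR' : AnalyticAt ℂ R' 0)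
    {b : B} (hb : IsUnit b)
    (h : ∀ᶠ t : ℂ in 𝓝 0, invCauchy R (t • b) = invCauchy R' (t • b)) :
    ∀ᶠ t : ℂ in 𝓝[≠] 0, R (t • b) = R' (t • b) := by
  have hu : ∀ {Q : B → B}, AnalyticAt ℂ Q 0 →
      ∀ᶠ t : ℂ in 𝓝 0, IsUnit (1 + t • b * Q (t • b)) := by
    intro Q hQ
    have h1 : ContinuousAt (fun t : ℂ => Q (t • b)) 0 :=
      ContinuousAt.comp (g := Q) (by rw [zero_smul]; exact hQ.continuousAt) (by fun_prop)
    have h2 : ContinuousAt (fun t : ℂ => 1 + t • b * Q (t • b)) 0 :=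
      continuousAt_const.add (ContinuousAt.mul (by fun_prop) h1)
    exact h2.eventually_mem (Units.isOpen.mem_nhds (by simp))
  filter_upwards [nhdsWithin_le_nhds h, nhdsWithin_le_nhds (hu hR), nhdsWithin_le_nhds (hu hR'),
    self_mem_nhdsWithin] with t ht h1 h2 ht0
  have htb : IsUnit (t • b) := hb.smul (Units.mk0 t ht0)
  have h3 : Ring.inverse (1 + t • b * R (t • b)) = Ring.inverse (1 + t • b * R' (t • b)) :=
    htb.mul_right_cancel ht
  have h4 : 1 + t • b * R (t • b) = 1 + t • b * R' (t • b) := by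
    rw [← Ring.inverse_inverse h1, h3, Ring.inverse_inverse h2]
  exact htb.mul_left_cancel (add_left_cancel h4)

lemma eventuallyEq_zero_of_isUnit {Q : B → B} (hQ : AnalyticAt ℂ Q 0)
    (h : ∀ b : B, IsUnit b → ∀ᶠ t : ℂ in 𝓝[≠] 0, Q (t • b) = 0) :
    ∀ᶠ b in 𝓝 (0 : B), Q b = 0 := by
  obtain ⟨r, hr, hball⟩ := hQ.exists_ball_analyticOnNhd
  have hunit : ∀ b ∈ Metric.ball (0 : B) r, IsUnit b → Q b = 0 := by
    intro b hb hbu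
    let l : ℂ →L[ℂ] B := (ContinuousLinearMap.id ℂ ℂ).smulRight b
    have hl : ∀ t, l t = t • b := fun t => rfl
    have hconv : Convex ℝ (l ⁻¹' Metric.ball (0 : B) r) :=
      (convex_ball (0 : B) r).is_linear_preimage
        (l.restrictScalars ℝ).toLinearMap.isLinear
    have han : AnalyticOnNhd ℂ (fun t => Q (l t)) (l ⁻¹' Metric.ball (0 : B) r) := by
      intro t ht
      exact AnalyticAt.fun_comp (g := Q) (hball _ ht) (l.analyticAt t)
    have h0 : (0 : ℂ) ∈ l ⁻¹' Metric.ball (0 : B) r := by simp [hl, hr]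
    have h1 : (1 : ℂ) ∈ l ⁻¹' Metric.ball (0 : B) r := by simpa [hl] using hb
    have := han.eqOn_zero_of_preconnected_of_frequently_eq_zero hconv.isPreconnected h0
      (h b hbu).frequently h1
    simpa [hl] using this
  obtain ⟨t, htr, ht⟩ : ∃ t : ℂ, t • (1 : B) ∈ Metric.ball (0 : B) r ∧ t ≠ 0 := by
    have h1 : ∀ᶠ t : ℂ in 𝓝 0, t • (1 : B) ∈ Metric.ball (0 : B) r := by
      have : ContinuousAt (fun t : ℂ => t • (1 : B)) 0 := by fun_prop
      exact this.eventually_mem (by simpa using Metric.ball_mem_nhds (0 : B) hr)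
    have h2 : ∀ᶠ t : ℂ in 𝓝[≠] 0, t • (1 : B) ∈ Metric.ball (0 : B) r ∧ t ≠ 0 :=
      (h1.filter_mono nhdsWithin_le_nhds).and self_mem_nhdsWithin
    exact h2.exists
  have htu : IsUnit (t • (1 : B)) := isUnit_one.smul (Units.mk0 t ht)
  have hloc : Q =ᶠ[𝓝 (t • (1 : B))] 0 := by
    filter_upwards [Metric.isOpen_ball.mem_nhds htr, Units.isOpen.mem_nhds htu] with x hx hxu
    exact hunit x hx hxu
  have heq := hball.eqOn_zero_of_preconnected_of_eventuallyEq_zero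
    (convex_ball (0 : B) r).isPreconnected htr hloc
  filter_upwards [Metric.ball_mem_nhds (0 : B) hr] with b hb
  exact heq hb

theorem eventually_eq_modelR {e : ι → I} (he : Function.Injective e) {R : B → B}
    (hR : S.IsRTransform (S.modelOp e N a) R) : ∀ᶠ b in 𝓝 (0 : B), R b = modelR N a b := by
  have hH := analyticAt_modelR N a 0
  have h := eventuallyEq_zero_of_isUnit (hR.1.sub hH) fun b hb => by
    filter_upwards [eventually_eq_of_isUnit hR.1 hH hb (S.eventually_invCauchy_eq N a he hR b)]
      with t ht
    simpa using sub_eq_zero.2 ht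
  filter_upwards [h] with b hb
  exact sub_eq_zero.1 hb

end Model

end FockSetup

/-- Lemma 4.6: additivity for the model operators: with `X = L₁ + ∑_{n=0}^{N} V_{1,n}(αₙ)`,
`Y = L₂ + ∑_{n=0}^{N} V_{2,n}(βₙ)` (indices `1, 2 ∈ {1,2}` are `0, 1 : Fin 2`),
`F(b) = ∑_{n=0}^N αₙ(b,…,b)` and `G(b) = ∑_{n=0}^N βₙ(b,…,b)`, one has
`R_{X+Y}(b) = F(b) + G(b) = R_X(b) + R_Y(b)` near `0`. -/
theorem stmt_18 (S : FockSetup B (Fin 2) F) (N : ℕ) (hN : 1 ≤ N)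
    (α β : (n : ℕ) → ContinuousMultilinearMap ℂ (fun _ : Fin n => B) B)
    (X Y : F →L[ℂ] F)
    (hX : X = S.L 0 + ∑ n ∈ Finset.range (N + 1), S.V 0 n (α n))
    (hY : Y = S.L 1 + ∑ n ∈ Finset.range (N + 1), S.V 1 n (β n)) :
    ∀ Rx Ry Rxy : B → B, S.IsRTransform X Rx → S.IsRTransform Y Ry →
      S.IsRTransform (X + Y) Rxy →
      ∀ᶠ b in nhds (0 : B),
        Rxy b = (∑ n ∈ Finset.range (N + 1), α n (fun _ => b)) +
            (∑ n ∈ Finset.range (N + 1), β n (fun _ => b)) ∧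
        Rxy b = Rx b + Ry b := by
  intro Rx Ry Rxy hRx hRy hRxy
  have hX' : X = S.modelOp (fun _ : Unit => 0) N fun _ => α := by simp [FockSetup.modelOp, hX]
  have hY' : Y = S.modelOp (fun _ : Unit => 1) N fun _ => β := by simp [FockSetup.modelOp, hY]
  have hXY' : X + Y = S.modelOp id N ![α, β] := by simp [FockSetup.modelOp, hX, hY]
  rw [hXY'] at hRxy
  rw [hX'] at hRx
  rw [hY'] at hRy
  filter_upwards [S.eventually_eq_modelR N _ (Function.injective_of_subsingleton _) hRx,
    S.eventually_eq_modelR N _ (Function.injective_of_subsingleton _) hRy,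
    S.eventually_eq_modelR N _ Function.injective_id hRxy] with b h1 h2 h3
  rw [h1, h2, h3]
  simp [FockSetup.modelR]
end
end
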